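/- Every isodyne topological space X whose cardinality |X| is a regular uncountable cardinal contains a crowded subspace which is either |X|-carvable or ω-resolvable. -/

import Mathlib

open Cardinal Topology

/-- A space is `κ`-resolvable iff there are `κ`-many pairwise disjoint dense subsets. -/
def IsResolvable (κ : Cardinal) (X : Type*) [TopologicalSpace X] : Prop :=
  ∃ D : Set (Set X), #D = κ ∧ D.PairwiseDisjoint id ∧ ∀ A ∈ D, Dense A

/-- A space is isodyne iff every nonempty open subset has the cardinality of the whole space. -/
def Isodyne (X : Type*) [TopologicalSpace X] : Prop :=
  ∀ U : Set X, IsOpen U → U.Nonempty → #U = #X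

/-- A space is crowded iff it has no isolated points. -/
def Crowded (X : Type*) [TopologicalSpace X] : Prop :=
  ∀ x : X, ¬ IsOpen ({x} : Set X)

/-- A set `A` is `κ`-remote iff `A ∩ cl S = ∅` whenever `S ⊆ X \ A` and `|S| < κ`. -/
def Remote (κ : Cardinal) {X : Type*} [TopologicalSpace X] (A : Set X) : Prop :=
  ∀ S : Set X, S ⊆ Aᶜ → #S < κ → A ∩ closure S = ∅

/-- A `κ`-carving on `X` is a pairwise disjoint family `𝒜` of nonempty `κ`-remote subsets
such that (C1) `|⋃ℋ| < κ` whenever `ℋ ⊆ 𝒜` and `|ℋ| < κ`, and (C2) for every nonempty open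
`U ⊆ X` the family `{A ∈ 𝒜 | A ∩ U ≠ ∅}` has cardinality `κ`. -/
def IsCarving (κ : Cardinal) {X : Type*} [TopologicalSpace X] (𝒜 : Set (Set X)) : Prop :=
  𝒜.PairwiseDisjoint id ∧ (∀ A ∈ 𝒜, A.Nonempty ∧ Remote κ A) ∧
  (∀ ℋ : Set (Set X), ℋ ⊆ 𝒜 → #ℋ < κ → #(⋃₀ ℋ) < κ) ∧
  (∀ U : Set X, IsOpen U → U.Nonempty → #{A : Set X // A ∈ 𝒜 ∧ (A ∩ U).Nonempty} = κ)

/-- A space is `κ`-carvable iff there is a `κ`-carving on it. -/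
def Carvable (κ : Cardinal) (X : Type*) [TopologicalSpace X] : Prop :=
  ∃ 𝒜 : Set (Set X), IsCarving κ 𝒜

open Set

universe u

section Cardinality

variable {X : Type u} {κ : Cardinal.{u}}

theorem mk_union_lt_of_isRegular (hκ : κ.IsRegular) {A B : Set X} (hA : #A < κ) (hB : #B < κ) :
    #(A ∪ B : Set X) < κ :=
  (mk_union_le A B).trans_lt (add_lt_of_lt hκ.aleph0_le hA hB)

theorem mk_iUnion_nat_lt_of_isRegular (hκ : κ.IsRegular) (hunc : ℵ₀ < κ) {T : ℕ → Set X}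
    (hT : ∀ n, #(T n) < κ) : #(⋃ n, T n) < κ := by
  have h : (⋃ n, T n) = ⋃ n : ULift.{u} ℕ, T n.down := by
    ext x
    simp
  rw [h, card_iUnion_lt_iff_forall_of_isRegular hκ (by simpa using hunc)]
  exact fun n => hT n.down

theorem mk_biUnion_lt_of_isRegular (hκ : κ.IsRegular) {A : Set X} (hA : #A < κ)
    {B : X → Set X} (hB : ∀ x ∈ A, #(B x) < κ) : #(⋃ x ∈ A, B x) < κ :=
  (card_biUnion_lt_iff_forall_of_isRegular (t := fun x _ => B x) hκ hA).2 hB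

theorem mk_singleton_lt_of_isRegular (hκ : κ.IsRegular) (x : X) : #({x} : Set X) < κ := by
  rw [mk_singleton]
  exact one_lt_aleph0.trans_le hκ.aleph0_le

/-- A set-valued map with values of size less than a regular uncountable `κ` admits a rank
with fibers of size less than `κ` that does not increase along the map. -/
theorem exists_rank_of_small (hκ : κ.IsRegular) (hunc : ℵ₀ < κ) (B : X → Set X)
    (hB : ∀ x, #(B x) < κ) [LinearOrder X] [WellFoundedLT X] :
    ∃ ρ : X → X, (∀ a, #{x | ρ x = a} < κ) ∧ ∀ x, ∀ y ∈ B x, ρ y ≤ ρ x := by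
  let T : X → ℕ → Set X := fun x n => Nat.rec {x} (fun _ A => ⋃ a ∈ A, B a) n
  let C : X → Set X := fun x => ⋃ n, T x n
  have hT : ∀ (x : X) (n : ℕ), #↥(T x n) < κ := by
    intro x n
    induction n with
    | zero => exact mk_singleton_lt_of_isRegular hκ x
    | succ n ih => exact mk_biUnion_lt_of_isRegular hκ ih fun a _ => hB a
  have hC : ∀ x, #(C x) < κ := fun x => mk_iUnion_nat_lt_of_isRegular hκ hunc (hT x)
  have hself : ∀ x, x ∈ C x := fun x => mem_iUnion.2 ⟨0, rfl⟩
  have hstep : ∀ z x y, x ∈ C z → y ∈ B x → y ∈ C z := by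
    intro z x y hx hy
    obtain ⟨n, hn⟩ := mem_iUnion.1 hx
    exact mem_iUnion.2 ⟨n + 1, mem_biUnion (show x ∈ T z n from hn) hy⟩
  have hmin : ∀ y, ∃ a, y ∈ C a ∧ ∀ b, y ∈ C b → a ≤ b := by
    intro y
    obtain ⟨a, ha, hle⟩ := WellFounded.has_min (wellFounded_lt (α := X)) {a | y ∈ C a}
      ⟨y, hself y⟩
    exact ⟨a, ha, fun b hb => not_lt.1 (hle b hb)⟩
  choose ρ hρ hρle using hmin
  refine ⟨ρ, fun a => (mk_le_mk_of_subset ?_).trans_lt (hC a), fun x y hy => ?_⟩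
  · rintro x rfl
    exact hρ x
  · exact hρle y _ (hstep _ x y (hρ x) hy)

end Cardinality

section Resolvability

variable {X : Type u} [TopologicalSpace X] {κ : Cardinal.{u}}

theorem IsResolvable.crowded {Y : Type u} [TopologicalSpace Y] (h : IsResolvable ℵ₀ Y) :
    Crowded Y := by
  rintro x hx
  obtain ⟨D, hD, hdis, hdense⟩ := h
  have hmem : ∀ A ∈ D, x ∈ A := by
    intro A hA
    obtain ⟨y, hy, hyA⟩ := (hdense A hA).inter_open_nonempty _ hx ⟨x, rfl⟩
    rw [mem_singleton_iff] at hy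
    exact hy ▸ hyA
  have hsub : D.Subsingleton := fun A hA B hB =>
    hdis.elim hA hB (not_disjoint_iff.2 ⟨x, hmem A hA, hmem B hB⟩)
  have h1 : #D ≤ 1 := by
    rw [mk_le_one_iff_set_subsingleton]
    exact hsub
  rw [hD] at h1
  exact absurd one_lt_aleph0 (not_lt.2 h1)

theorem Carvable.crowded {Y : Type u} [TopologicalSpace Y] (hκ : 1 < κ) (h : Carvable κ Y) :
    Crowded Y := by
  rintro x hx
  obtain ⟨𝒜, hdis, -, -, hU⟩ := h
  have h1 : #{A : Set Y // A ∈ 𝒜 ∧ (A ∩ {x}).Nonempty} ≤ 1 := by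
    rw [le_one_iff_subsingleton]
    refine ⟨fun ⟨A, hA, hAx⟩ ⟨B, hB, hBx⟩ => Subtype.ext ?_⟩
    rw [inter_singleton_nonempty] at hAx hBx
    exact hdis.elim hA hB (not_disjoint_iff.2 ⟨x, hAx, hBx⟩)
  rw [hU _ hx ⟨x, rfl⟩] at h1
  exact absurd hκ (not_lt.2 h1)

theorem isResolvable_of_seq {M : Set X} (hM : M.Nonempty) (D : ℕ → Set X)
    (hsub : ∀ n, D n ⊆ M) (hdis : Pairwise (Function.onFun Disjoint D))
    (hdense : ∀ n, M ⊆ closure (D n)) : IsResolvable ℵ₀ M := by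
  let E : ℕ → Set M := fun n => Subtype.val ⁻¹' D n
  have hE : ∀ n, Dense (E n) := by
    intro n x
    rw [closure_subtype, Subtype.image_preimage_coe, inter_eq_right.2 (hsub n)]
    exact hdense n x.2
  have hEdis : Pairwise (Function.onFun Disjoint E) := fun i j hij =>
    (hdis hij).preimage _
  have hinj : Function.Injective E := by
    intro i j hij
    by_contra hne
    have h := hEdis hne
    rw [Function.onFun, hij, disjoint_self] at h
    have : Nonempty M := hM.to_subtype
    exact (hE j).nonempty.ne_empty h
  refine ⟨range E, ?_, ?_, ?_⟩
  · simpa using mk_range_eq_of_injective hinj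
  · rintro _ ⟨i, rfl⟩ _ ⟨j, rfl⟩ hij
    exact hEdis fun h => hij (h ▸ rfl)
  · rintro _ ⟨n, rfl⟩
    exact hE n

/-- If every point of `Y` is a limit of small subsets of `Y` avoiding any given small set, then
`Y` has a nonempty `ω`-resolvable subspace. -/
theorem exists_isResolvable_of_forall_mem_closure (hκ : κ.IsRegular) {Y : Set X}
    (hY : Y.Nonempty)
    (h : ∀ y ∈ Y, ∀ B : Set X, #B < κ → ∃ S ⊆ Y \ B, #S < κ ∧ y ∈ closure S) :
    ∃ D : Set X, D.Nonempty ∧ IsResolvable ℵ₀ D := by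
  have hnext : ∀ A B : Set X, ∃ S : Set X, A ⊆ Y → #A < κ → #B < κ →
      S ⊆ Y \ B ∧ #S < κ ∧ A ⊆ closure S := by
    intro A B
    by_cases hA : A ⊆ Y ∧ #A < κ ∧ #B < κ
    · obtain ⟨hAY, hAκ, hB⟩ := hA
      have h' : ∀ y, ∃ S : Set X, y ∈ A → S ⊆ Y \ B ∧ #S < κ ∧ y ∈ closure S := by
        intro y
        by_cases hy : y ∈ A
        · obtain ⟨S, hS⟩ := h y (hAY hy) B hB
          exact ⟨S, fun _ => hS⟩
        · exact ⟨∅, fun h => absurd h hy⟩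
      choose S hS using h'
      refine ⟨⋃ y ∈ A, S y, fun _ _ _ => ⟨iUnion₂_subset fun y hy => (hS y hy).1,
        mk_biUnion_lt_of_isRegular hκ hAκ fun y hy => (hS y hy).2.1, fun y hy => ?_⟩⟩
      exact closure_mono (subset_biUnion_of_mem hy) (hS y hy).2.2
    · exact ⟨∅, fun h1 h2 h3 => absurd ⟨h1, h2, h3⟩ hA⟩
  choose next hnext using hnext
  obtain ⟨y₀, hy₀⟩ := hY
  let P : ℕ → Set X × Set X := fun n =>
    Nat.rec ({y₀}, {y₀}) (fun _ p => (next p.1 p.2, p.2 ∪ next p.1 p.2)) n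
  let T : ℕ → Set X := fun n => (P n).1
  let B : ℕ → Set X := fun n => (P n).2
  have hinv : ∀ n, T n ⊆ Y ∧ #(T n) < κ ∧ #(B n) < κ ∧ T n ⊆ B n := by
    intro n
    induction n with
    | zero =>
      exact ⟨singleton_subset_iff.2 hy₀, mk_singleton_lt_of_isRegular hκ y₀,
        mk_singleton_lt_of_isRegular hκ y₀, Subset.rfl⟩
    | succ n ih =>
      obtain ⟨h1, h2, -⟩ := hnext (T n) (B n) ih.1 ih.2.1 ih.2.2.1
      exact ⟨h1.trans sdiff_subset, h2, mk_union_lt_of_isRegular hκ ih.2.2.1 h2,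
        subset_union_right⟩
  have hsucc : ∀ n, T (n + 1) ⊆ Y \ B n ∧ T n ⊆ closure (T (n + 1)) := fun n =>
    have h' := hnext (T n) (B n) (hinv n).1 (hinv n).2.1 (hinv n).2.2.1
    ⟨h'.1, h'.2.2⟩
  have hBmono : Monotone B := monotone_nat_of_le_succ fun n => subset_union_left
  have hlt : ∀ m n, m < n → Disjoint (T m) (T n) := by
    intro m n hmn
    obtain ⟨k, rfl⟩ := Nat.exists_eq_succ_of_ne_zero (Nat.ne_zero_of_lt hmn)
    have hsub : T m ⊆ B k := (hinv m).2.2.2.trans (hBmono (Nat.lt_succ_iff.1 hmn))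
    exact disjoint_left.2 fun x hx hx' => ((hsucc k).1 hx').2 (hsub hx)
  have hdis : ∀ m n, m ≠ n → Disjoint (T m) (T n) := fun m n hmn =>
    hmn.lt_or_gt.elim (hlt m n) fun h => (hlt n m h).symm
  have hcl : ∀ m n, m ≤ n → T m ⊆ closure (T n) := by
    intro m n hmn
    induction n, hmn using Nat.le_induction with
    | base => exact subset_closure
    | succ n _ ih => exact ih.trans (closure_minimal (hsucc n).2 isClosed_closure)
  have hne : (⋃ n, T n).Nonempty := ⟨y₀, mem_iUnion.2 ⟨0, rfl⟩⟩
  refine ⟨⋃ n, T n, hne, isResolvable_of_seq hne (fun k => ⋃ m, T (Nat.pair k m)) ?_ ?_ ?_⟩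
  · exact fun k => iUnion_subset fun m => subset_iUnion T _
  · intro k l hkl
    refine disjoint_iUnion_left.2 fun m => disjoint_iUnion_right.2 fun n => hdis _ _ fun h => ?_
    exact hkl (Nat.pair_eq_pair.1 h).1
  · refine fun k => iUnion_subset fun n => (hcl n _ (Nat.right_le_pair k n)).trans ?_
    exact closure_mono (subset_iUnion (fun m => T (Nat.pair k m)) n)

end Resolvability

/-- Every relatively open nonempty subset of `M` has size at least `κ`. -/
def Thick {X : Type u} [TopologicalSpace X] (κ : Cardinal.{u}) (M : Set X) : Prop :=
  ∀ O : Set X, IsOpen O → (O ∩ M).Nonempty → κ ≤ #(O ∩ M : Set X)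

section Thick

variable {X : Type u} [TopologicalSpace X] {κ : Cardinal.{u}}

/-- Given an operation `G` choosing a dense subset of each subset, a thick set is
`ω`-resolvable unless `G` yields a thick set of the form `V ∩ G Y` with `V` open. -/
theorem isResolvable_or_exists_thick (hκ : κ.IsRegular) {M : Set X} (hM : M.Nonempty)
    (hthick : Thick κ M) (G : Set X → Set X) (hsub : ∀ Y, G Y ⊆ Y)
    (hdense : ∀ Y ⊆ M, Y ⊆ closure (G Y)) :
    IsResolvable ℵ₀ M ∨
      ∃ Y ⊆ M, ∃ V : Set X, (V ∩ G Y).Nonempty ∧ Thick κ (V ∩ G Y) := by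
  refine or_iff_not_imp_right.2 fun hno => ?_
  have hsmall : ∀ Y ⊆ M, ∀ V : Set X, (V ∩ G Y).Nonempty →
      ∃ O, IsOpen O ∧ (O ∩ (V ∩ G Y)).Nonempty ∧ #(O ∩ (V ∩ G Y) : Set X) < κ := by
    intro Y hY V hV
    by_contra! hcon
    exact hno ⟨Y, hY, V, hV, hcon⟩
  let Y : ℕ → Set X := fun n => Nat.rec M (fun _ Z => Z \ G Z) n
  have hYM : ∀ n, Y n ⊆ M := by
    intro n
    induction n with
    | zero => exact Subset.rfl
    | succ n ih => exact sdiff_subset.trans ih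
  have hYanti : Antitone Y := antitone_nat_of_succ_le fun n => sdiff_subset
  have hdense_of : ∀ n, (∀ O, IsOpen O → (O ∩ M).Nonempty → ∃ O' ⊆ O, IsOpen O' ∧
      (O' ∩ M).Nonempty ∧ #((O' ∩ M) \ Y n : Set X) < κ) → M ⊆ closure (G (Y n)) := by
    intro n hn
    refine Subset.trans (fun x hx => ?_) (closure_minimal (hdense _ (hYM n)) isClosed_closure)
    rw [mem_closure_iff]
    intro O hO hxO
    obtain ⟨O', hO'O, hO', hne, hlt⟩ := hn O hO ⟨x, hxO, hx⟩
    by_contra hemp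
    refine (hthick O' hO' hne).not_gt ((mk_le_mk_of_subset ?_).trans_lt hlt)
    exact fun y hy => ⟨hy, fun hyY => hemp ⟨y, hO'O hy.1, hyY⟩⟩
  have hcosmall : ∀ n, ∀ O, IsOpen O → (O ∩ M).Nonempty → ∃ O' ⊆ O, IsOpen O' ∧
      (O' ∩ M).Nonempty ∧ #((O' ∩ M) \ Y n : Set X) < κ := by
    intro n
    induction n with
    | zero =>
      intro O hO hne
      refine ⟨O, Subset.rfl, hO, hne, ?_⟩
      have : (O ∩ M) \ Y 0 = ∅ := sdiff_eq_empty.2 inter_subset_right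
      rw [this, mk_eq_zero]
      exact hκ.pos
    | succ n ih =>
      intro O hO hne
      obtain ⟨O', hO'O, hO', ⟨x, hxO', hxM⟩, hlt⟩ := ih O hO hne
      obtain ⟨W, hW, ⟨y, hyW, hyO', hyG⟩, hWlt⟩ := hsmall (Y n) (hYM n) O'
        (mem_closure_iff.1 (hdense_of n ih hxM) O' hO' hxO')
      refine ⟨O' ∩ W, inter_subset_left.trans hO'O, hO'.inter hW,
        ⟨y, ⟨hyO', hyW⟩, hYM n (hsub _ hyG)⟩,
        (mk_le_mk_of_subset ?_).trans_lt (mk_union_lt_of_isRegular hκ hlt hWlt)⟩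
      rintro z ⟨⟨⟨hzO', hzW⟩, hzM⟩, hz⟩
      rcases Classical.em (z ∈ Y n) with hzY | hzY
      · exact Or.inr ⟨hzW, hzO', by_contra fun hzG => hz ⟨hzY, hzG⟩⟩
      · exact Or.inl ⟨⟨hzO', hzM⟩, hzY⟩
  have hlt : ∀ m n, m < n → Disjoint (G (Y m)) (G (Y n)) := fun m n hmn =>
    disjoint_left.2 fun x hx hx' => (hYanti (Nat.succ_le_of_lt hmn) (hsub _ hx')).2 hx
  refine isResolvable_of_seq hM (fun n => G (Y n)) (fun n => (hsub _).trans (hYM n)) ?_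
    fun n => hdense_of n (hcosmall n)
  exact fun m n hmn => hmn.lt_or_gt.elim (hlt m n) fun h => (hlt n m h).symm

/-- A thick set is carved by the fibers of a rank with small fibers, provided that no point is a
limit of the points of lower rank, nor of a small set of points of higher rank. -/
theorem carvable_of_rank {X : Type u} [TopologicalSpace X] [LinearOrder X] (hκ : (#X).IsRegular)
    {N : Set X} (hthick : Thick (#X) N) (ρ : X → X) (hfib : ∀ a, #{x | ρ x = a} < #X)
    (hlow : ∀ x ∈ N, x ∉ closure {y ∈ N | ρ y < ρ x})
    (hhigh : ∀ x ∈ N, ∀ S ⊆ {y ∈ N | ρ x < ρ y}, #S < #X → x ∉ closure S) :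
    Carvable (#X) N := by
  let F : X → Set N := fun a => {x | ρ x = a}
  let 𝒜 : Set (Set N) := {A | A.Nonempty ∧ ∃ a, A = F a}
  have hF : ∀ a, #(F a) < #X := fun a =>
    (mk_preimage_of_injective _ {x | ρ x = a} Subtype.val_injective).trans_lt (hfib a)
  have hC1 : ∀ ℋ : Set (Set N), ℋ ⊆ 𝒜 → #ℋ < #X → #(⋃₀ ℋ) < #X := by
    intro ℋ hℋ hlt
    rw [sUnion_eq_biUnion]
    refine (card_biUnion_lt_iff_forall_of_isRegular (t := fun A _ => A) hκ hlt).2 ?_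
    intro A hA
    obtain ⟨-, a, rfl⟩ := hℋ hA
    exact hF a
  refine ⟨𝒜, ?_, ?_, hC1, ?_⟩
  · rintro _ ⟨-, a, rfl⟩ _ ⟨-, b, rfl⟩ hab
    refine disjoint_left.2 fun x (hxa : ρ x = a) (hxb : ρ x = b) => hab ?_
    rw [← hxa, ← hxb]
  · rintro _ ⟨hne, a, rfl⟩
    refine ⟨hne, fun S hS hSlt => eq_empty_of_forall_notMem ?_⟩
    rintro x ⟨rfl, hx⟩
    rw [closure_subtype] at hx
    have hcover : Subtype.val '' S ⊆
        {y ∈ N | ρ y < ρ x} ∪ (Subtype.val '' S ∩ {y ∈ N | ρ x < ρ y}) := by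
      rintro _ ⟨y, hy, rfl⟩
      rcases lt_trichotomy (ρ y) (ρ x) with h | h | h
      · exact Or.inl ⟨y.2, h⟩
      · exact absurd h (hS hy)
      · exact Or.inr ⟨mem_image_of_mem _ hy, y.2, h⟩
    have hx' := closure_mono hcover hx
    rw [closure_union] at hx'
    exact hx'.elim (hlow x x.2) (hhigh x x.2 _ inter_subset_right
      ((mk_le_mk_of_subset inter_subset_left).trans_lt (mk_image_le.trans_lt hSlt)))
  · rintro U hU ⟨x₀, hx₀⟩
    let 𝒰 : Set (Set N) := {A | A ∈ 𝒜 ∧ (A ∩ U).Nonempty}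
    change #𝒰 = #X
    refine le_antisymm ?_ (not_lt.1 fun hlt => ?_)
    · refine (mk_le_mk_of_subset ?_).trans (mk_range_le (f := F))
      rintro _ ⟨⟨-, a, rfl⟩, -⟩
      exact ⟨a, rfl⟩
    · obtain ⟨O, hO, rfl⟩ := isOpen_induced_iff.1 hU
      have hle := hthick O hO ⟨x₀, hx₀, x₀.2⟩
      refine hle.not_gt (lt_of_le_of_lt ?_ (hC1 𝒰 (fun A hA => hA.1) hlt))
      refine (mk_le_mk_of_subset ?_).trans (mk_image_le (f := (Subtype.val : N → X)))
      rintro y ⟨hyO, hyN⟩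
      exact ⟨⟨y, hyN⟩, ⟨F (ρ y), ⟨⟨⟨⟨y, hyN⟩, rfl⟩, ρ y, rfl⟩, ⟨⟨y, hyN⟩, rfl, hyO⟩⟩, rfl⟩, rfl⟩

end Thick

/-- The subspace in the main theorem can be taken nonempty. -/
theorem exists_nonempty_carvable_or_omega_resolvable_subspace {X : Type u} [TopologicalSpace X]
    (hiso : Isodyne X) (hreg : (#X).IsRegular) (hunc : ℵ₀ < #X) :
    ∃ S : Set X, S.Nonempty ∧ (Carvable (#X) S ∨ IsResolvable ℵ₀ S) := by
  by_cases hres : ∃ D : Set X, D.Nonempty ∧ IsResolvable ℵ₀ D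
  · obtain ⟨D, hD, h⟩ := hres
    exact ⟨D, hD, Or.inr h⟩
  have hX : (univ : Set X).Nonempty := by
    have : Nonempty X := mk_ne_zero_iff.1 hreg.ne_zero
    exact univ_nonempty
  have hthick : Thick (#X) (univ : Set X) := by
    intro O hO hne
    rw [inter_univ] at hne ⊢
    exact (hiso O hO hne).ge
  let Z : Set X → Set X := fun Y =>
    {x ∈ Y | ∃ B : Set X, #B < #X ∧ ∀ S ⊆ Y \ B, #S < #X → x ∉ closure S}
  have hZdense : ∀ Y, Y ⊆ closure (Z Y) := by
    intro Y x hx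
    rw [mem_closure_iff]
    intro O hO hxO
    by_contra hemp
    refine hres (exists_isResolvable_of_forall_mem_closure (Y := O ∩ Y) hreg ⟨x, hxO, hx⟩ ?_)
    rintro y ⟨hyO, hyY⟩ B hB
    by_contra! hcon
    refine hemp ⟨y, hyO, hyY, B, hB, fun S hS hSlt hyS => ?_⟩
    refine hcon (O ∩ S) (fun z hz => ⟨⟨hz.1, (hS hz.2).1⟩, (hS hz.2).2⟩)
      ((mk_le_mk_of_subset inter_subset_right).trans_lt hSlt) ?_
    exact hO.inter_closure ⟨hyO, hyS⟩
  rcases isResolvable_or_exists_thick hreg hX hthick Z (fun Y => sep_subset _ _)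
    (fun Y _ => hZdense Y) with h | ⟨Y, -, V, hMne, hMthick⟩
  · exact absurd ⟨_, hX, h⟩ hres
  have hB : ∀ x, ∃ B : Set X, #B < #X ∧
      (x ∈ V ∩ Z Y → ∀ S ⊆ Y \ B, #S < #X → x ∉ closure S) := by
    intro x
    by_cases hx : x ∈ V ∩ Z Y
    · obtain ⟨B, hB, h⟩ := hx.2.2
      exact ⟨B, hB, fun _ => h⟩
    · exact ⟨{x}, mk_singleton_lt_of_isRegular hreg x, fun h => absurd h hx⟩
  choose B hBlt hB using hB
  obtain ⟨_, _⟩ := exists_wellFoundedLT X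
  obtain ⟨ρ, hfib, hρ⟩ := exists_rank_of_small hreg hunc B hBlt
  let G : Set X → Set X := fun W => {x ∈ W | x ∉ closure {y ∈ W | ρ y < ρ x}}
  have hGdense : ∀ W, W ⊆ closure (G W) := by
    intro W x hx
    rw [mem_closure_iff]
    intro O hO hxO
    obtain ⟨y, ⟨hyO, hyW⟩, hmin⟩ := (InvImage.wf ρ (wellFounded_lt (α := X))).has_min (O ∩ W)
      ⟨x, hxO, hx⟩
    refine ⟨y, hyO, hyW, fun hy => ?_⟩
    obtain ⟨z, hzO, hzW, hz⟩ := mem_closure_iff.1 hy O hO hyO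
    exact hmin z ⟨hzO, hzW⟩ hz
  rcases isResolvable_or_exists_thick hreg hMne hMthick G (fun W => sep_subset _ _)
    (fun W _ => hGdense W) with h | ⟨W, hWM, V', hNne, hNthick⟩
  · exact absurd ⟨_, hMne, h⟩ hres
  refine ⟨V' ∩ G W, hNne, Or.inl (carvable_of_rank hreg hNthick ρ hfib ?_ ?_)⟩
  · exact fun x hx hcl => hx.2.2 (closure_mono (fun _ hy => And.intro hy.1.2.1 hy.2) hcl)
  · intro x hx S hS
    refine hB x (hWM hx.2.1) S fun y hy => ⟨(hWM (hS hy).1.2.1).2.1, fun hyB => ?_⟩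
    exact (hρ x y hyB).not_gt (hS hy).2

/-- Every isodyne space of regular uncountable cardinality contains a crowded subspace which
is either `|X|`-carvable or `ω`-resolvable. -/
theorem exists_crowded_carvable_or_omega_resolvable_subspace
    {X : Type*} [TopologicalSpace X]
    (hiso : Isodyne X) (hreg : (#X).IsRegular) (hunc : ℵ₀ < #X) :
    ∃ S : Set X, Crowded S ∧ (Carvable (#X) S ∨ IsResolvable ℵ₀ S) := by
  obtain ⟨S, -, hS⟩ := exists_nonempty_carvable_or_omega_resolvable_subspace hiso hreg hunc
  exact ⟨S, hS.elim (Carvable.crowded (one_lt_aleph0.trans hunc)) IsResolvable.crowded, hS⟩
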